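/- Let T ⊂ 𝔞⁺ drift away from walls (i.e. for every s > 0 there is t ∈ T with min_i t_i > s) and let 0 < ε < 1/2. Then the set DI_ε(T) of m×n real matrices Y for which the weighted Dirichlet theorem can be ε-improved along T has Lebesgue measure zero. -/

import Mathlib

open MeasureTheory

/-- The cone `𝔞⁺` of weight vectors: all entries positive, and the first `m` entries
have the same sum as the last `n` entries. -/
def aPlus (m n : ℕ) : Set (Fin (m + n) → ℝ) :=
  {t | (∀ i, 0 < t i) ∧
    ∑ i : Fin m, t (Fin.castAdd n i) = ∑ j : Fin n, t (Fin.natAdd m j)}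

/-- `DI_ε(T)`: the set of `m × n` matrices `Y` for which the weighted Dirichlet theorem
can be `ε`-improved along `T`, i.e. for all `t ∈ T` of sufficiently large norm the system
`|Y_i q − p_i| < ε e^{−t_i}` (for `i ≤ m`), `|q_j| < ε e^{t_{m+j}}` (for `j ≤ n`)
has a solution with `q ∈ ℤⁿ \ {0}`, `p ∈ ℤᵐ`. -/
def DIset (m n : ℕ) (ε : ℝ) (T : Set (Fin (m + n) → ℝ)) : Set (Fin m → Fin n → ℝ) :=
  {Y | ∃ t₀ : ℝ, ∀ t ∈ T, t₀ < ‖t‖ →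
    ∃ (q : Fin n → ℤ) (p : Fin m → ℤ), q ≠ 0 ∧
      (∀ i : Fin m,
        |∑ j : Fin n, Y i j * (q j : ℝ) - (p i : ℝ)| < ε * Real.exp (-(t (Fin.castAdd n i)))) ∧
      (∀ j : Fin n, |(q j : ℝ)| < ε * Real.exp (t (Fin.natAdd m j)))}


theorem di_one_dim (k a δ x r : ℝ) (hk : k ≠ 0) (hδ : 0 < δ) (hδ' : δ ≤ 1/2) (hr : 0 < r) :
    volume {y : ℝ | y ∈ Metric.closedBall x r ∧ ∃ p : ℤ, |y * k + a - p| < δ} ≤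
      ENNReal.ofReal (2 * δ * (2 * r + 2 / |k|)) := by
  have hk' : 0 < |k| := abs_pos.mpr hk
  set lo : ℝ := x * k + a - r * |k| - δ with hlo
  set hi : ℝ := x * k + a + r * |k| + δ with hhi
  have hsub : {y : ℝ | y ∈ Metric.closedBall x r ∧ ∃ p : ℤ, |y * k + a - p| < δ} ⊆
      ⋃ p ∈ Finset.Icc ⌈lo⌉ ⌊hi⌋, Metric.ball (((p : ℝ) - a) / k) (δ / |k|) := by
    rintro y ⟨hy, p, hp⟩
    rw [Metric.mem_closedBall, Real.dist_eq] at hy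
    have h1 : |(y - x) * k| ≤ r * |k| := by
      rw [abs_mul]; gcongr
    rw [abs_le] at h1
    have hp2 := abs_lt.mp hp
    simp only [Set.mem_iUnion, Finset.mem_Icc, exists_prop]
    refine ⟨p, ⟨Int.ceil_le.mpr ?_, Int.le_floor.mpr ?_⟩, ?_⟩
    · rw [hlo]; nlinarith
    · rw [hhi]; nlinarith
    · rw [Metric.mem_ball, Real.dist_eq, lt_div_iff₀ hk', ← abs_mul]
      have : (y - (p - a) / k) * k = y * k + a - p := by field_simp; ring
      rwa [this]
  refine (measure_mono hsub).trans ?_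
  refine (measure_biUnion_finset_le _ _).trans ?_
  simp only [Real.volume_ball, Finset.sum_const, nsmul_eq_mul, Int.card_Icc]
  have hlohi : 0 ≤ ⌊hi⌋ + 1 - ⌈lo⌉ := by
    have h1 : hi - 1 < ⌊hi⌋ := Int.sub_one_lt_floor hi
    have h2 : (⌈lo⌉ : ℝ) < lo + 1 := Int.ceil_lt_add_one lo
    have h3 : lo ≤ hi := by
      rw [hlo, hhi]; nlinarith [mul_pos hr hk']
    have : (-1 : ℝ) < ((⌊hi⌋ + 1 - ⌈lo⌉ : ℤ) : ℝ) := by push_cast; linarith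
    have : -1 < (⌊hi⌋ + 1 - ⌈lo⌉ : ℤ) := by exact_mod_cast this
    omega
  have hc : (((⌊hi⌋ + 1 - ⌈lo⌉).toNat : ℕ) : ℝ) ≤ 2 * r * |k| + 2 := by
    have : (((⌊hi⌋ + 1 - ⌈lo⌉).toNat : ℕ) : ℝ) = ((⌊hi⌋ + 1 - ⌈lo⌉ : ℤ) : ℝ) := by
      exact_mod_cast congrArg (Int.cast (R := ℝ)) (Int.toNat_of_nonneg hlohi)
    rw [this]; push_cast
    have h1 : (⌊hi⌋ : ℝ) ≤ hi := Int.floor_le hi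
    have h2 : lo ≤ (⌈lo⌉ : ℝ) := Int.le_ceil lo
    rw [hlo] at h2; rw [hhi] at h1
    rw [← hlo] at h2; rw [← hhi] at h1
    have : hi - lo = 2 * r * |k| + 2 * δ := by rw [hlo, hhi]; ring
    linarith
  rw [← ENNReal.ofReal_natCast, ← ENNReal.ofReal_mul (by positivity)]
  apply ENNReal.ofReal_le_ofReal
  calc _ ≤ (2 * r * |k| + 2) * (2 * (δ / |k|)) := by gcongr
    _ = _ := by field_simp

theorem di_multi_dim (n : ℕ) (q : Fin (n+1) → ℤ) (j₀ : Fin (n+1)) (hq : q j₀ ≠ 0)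
    (δ r : ℝ) (x : Fin (n+1) → ℝ) (hδ : 0 < δ) (hδ' : δ ≤ 1/2) (hr : 0 < r) :
    volume {y : Fin (n+1) → ℝ | y ∈ Metric.closedBall x r ∧
        ∃ p : ℤ, |∑ j, y j * (q j : ℝ) - p| < δ} ≤
      ENNReal.ofReal (2 * δ * (2 * r + 2 / |(q j₀ : ℝ)|) * (2 * r) ^ n) := by
  set S := {y : Fin (n+1) → ℝ | y ∈ Metric.closedBall x r ∧
        ∃ p : ℤ, |∑ j, y j * (q j : ℝ) - p| < δ} with hS
  have hmS : MeasurableSet S := by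
    have : S = Metric.closedBall x r ∩
        ⋃ p : ℤ, {y : Fin (n+1) → ℝ | |∑ j, y j * (q j : ℝ) - p| < δ} := by
      ext y; simp [hS]
    rw [this]
    refine Metric.isClosed_closedBall.measurableSet.inter (MeasurableSet.iUnion fun p => ?_)
    apply IsOpen.measurableSet
    exact isOpen_lt (by fun_prop) (by fun_prop)
  have hmp := (volume_preserving_piFinSuccAbove (fun _ : Fin (n+1) => ℝ) j₀).symm
  rw [← hmp.measure_preimage hmS.nullMeasurableSet]
  have hm2 := hmp.measurable hmS
  rw [Measure.volume_eq_prod, Measure.prod_apply_symm hm2]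
  set B : Set (Fin n → ℝ) := Metric.closedBall (fun j => x (j₀.succAbove j)) r with hB
  have hbound : ∀ z : Fin n → ℝ, volume ((fun w : ℝ => (w, z)) ⁻¹'
      ((MeasurableEquiv.piFinSuccAbove (fun _ : Fin (n+1) => ℝ) j₀).symm ⁻¹' S)) ≤
      B.indicator (fun _ => ENNReal.ofReal (2 * δ * (2 * r + 2 / |(q j₀ : ℝ)|))) z := by
    intro z
    by_cases hz : z ∈ B
    · rw [Set.indicator_of_mem hz]
      refine le_trans (measure_mono ?_) (di_one_dim (q j₀ : ℝ)
        (∑ j, z j * (q (j₀.succAbove j) : ℝ)) δ (x j₀) r (by exact_mod_cast hq) hδ hδ' hr)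
      rintro w ⟨h1, p, hp⟩
      rw [Fin.sum_univ_succAbove _ j₀] at hp
      simp [MeasurableEquiv.piFinSuccAbove, Fin.insertNthEquiv] at hp
      rw [mem_closedBall_iff_norm, pi_norm_le_iff_of_nonneg hr.le] at h1
      refine ⟨?_, p, hp⟩
      have := h1 j₀
      simp [MeasurableEquiv.piFinSuccAbove, Fin.insertNthEquiv] at this
      simpa [Real.dist_eq] using this
    · rw [Set.indicator_of_notMem hz]
      refine le_of_eq ?_
      convert measure_empty (μ := (volume : Measure ℝ))
      rw [Set.eq_empty_iff_forall_notMem]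
      rintro w ⟨h1, -⟩
      apply hz
      rw [mem_closedBall_iff_norm, pi_norm_le_iff_of_nonneg hr.le] at h1
      rw [hB, mem_closedBall_iff_norm, pi_norm_le_iff_of_nonneg hr.le]
      intro j
      have := h1 (j₀.succAbove j)
      simpa [MeasurableEquiv.piFinSuccAbove, Fin.insertNthEquiv] using this
  refine (lintegral_mono hbound).trans ?_
  rw [lintegral_indicator Metric.isClosed_closedBall.measurableSet, setLIntegral_const,
    Real.volume_pi_closedBall _ hr.le, ← ENNReal.ofReal_mul (by positivity)]
  simp

theorem di_matrix (m n : ℕ) (q : Fin (n+1) → ℤ) (j₀ : Fin (n+1)) (hq : q j₀ ≠ 0)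
    (δ : Fin m → ℝ) (r : ℝ) (X : Fin m → Fin (n+1) → ℝ) (hδ : ∀ i, 0 < δ i)
    (hδ' : ∀ i, δ i ≤ 1/2) (hr : 0 < r) :
    volume {Y : Fin m → Fin (n+1) → ℝ | Y ∈ Metric.closedBall X r ∧
        ∀ i, ∃ p : ℤ, |∑ j, Y i j * (q j : ℝ) - p| < δ i} ≤
      ENNReal.ofReal ((∏ i, (2 * δ i)) * (1 + 1 / (r * |(q j₀ : ℝ)|)) ^ m *
        ((2 * r) ^ (n+1)) ^ m) := by
  have hsub : {Y : Fin m → Fin (n+1) → ℝ | Y ∈ Metric.closedBall X r ∧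
        ∀ i, ∃ p : ℤ, |∑ j, Y i j * (q j : ℝ) - p| < δ i} ⊆
      Set.univ.pi (fun i => {y : Fin (n+1) → ℝ | y ∈ Metric.closedBall (X i) r ∧
        ∃ p : ℤ, |∑ j, y j * (q j : ℝ) - p| < δ i}) := by
    rintro Y ⟨h1, h2⟩ i -
    rw [closedBall_pi _ hr.le] at h1
    exact ⟨h1 i trivial, h2 i⟩
  refine (measure_mono hsub).trans ?_
  rw [volume_pi_pi]
  refine (Finset.prod_le_prod' fun i _ =>
    di_multi_dim n q j₀ hq (δ i) r (X i) (hδ i) (hδ' i) hr).trans ?_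
  have hk : 0 < |(q j₀ : ℝ)| := abs_pos.mpr (by exact_mod_cast hq)
  rw [← ENNReal.ofReal_prod_of_nonneg
    (fun i _ => by have := hδ i; positivity)]
  apply ENNReal.ofReal_le_ofReal
  apply le_of_eq
  calc _ = ∏ i : Fin m, ((2 * δ i) * ((1 + 1 / (r * |(q j₀ : ℝ)|)) * (2 * r) ^ (n+1))) := by
        refine Finset.prod_congr rfl fun i _ => ?_
        field_simp; ring
    _ = _ := by rw [Finset.prod_mul_distrib]; simp [mul_pow, mul_assoc]

/-- The set for a single `t`. -/
def diSingle (m n : ℕ) (ε : ℝ) (t : Fin (m + n) → ℝ) : Set (Fin m → Fin n → ℝ) :=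
  {Y | ∃ (q : Fin n → ℤ) (p : Fin m → ℤ), q ≠ 0 ∧
      (∀ i : Fin m,
        |∑ j : Fin n, Y i j * (q j : ℝ) - (p i : ℝ)| < ε * Real.exp (-(t (Fin.castAdd n i)))) ∧
      (∀ j : Fin n, |(q j : ℝ)| < ε * Real.exp (t (Fin.natAdd m j)))}

theorem di_sum (m n : ℕ) (ε : ℝ) (hε : 0 < ε) (hε' : ε < 1/2) (t : Fin (m + (n+1)) → ℝ)
    (ht : t ∈ aPlus m (n+1)) (X : Fin m → Fin (n+1) → ℝ) (r : ℝ) (hr : 0 < r)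
    (K : ℕ) (hK : 0 < K) :
    volume (diSingle m (n+1) ε t ∩ Metric.closedBall X r) ≤
      ENNReal.ofReal ((∏ i : Fin m, (2 * (ε * Real.exp (-(t (Fin.castAdd (n+1) i)))))) *
        ((1 + 1 / (r * K)) ^ m * ∏ j : Fin (n+1), (2 * (ε * Real.exp (t (Fin.natAdd m j))) + 1)
          + (2 * K + 1) ^ (n+1) * (1 + 1 / r) ^ m) * ((2 * r) ^ (n+1)) ^ m) := by
  classical
  set R : Fin (n+1) → ℝ := fun j => ε * Real.exp (t (Fin.natAdd m j)) with hR
  set δ : Fin m → ℝ := fun i => ε * Real.exp (-(t (Fin.castAdd (n+1) i))) with hδd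
  have hR0 : ∀ j, 0 < R j := fun j => by simp only [hR]; positivity
  have hδ : ∀ i, 0 < δ i := fun j => by simp only [hδd]; positivity
  have hδ' : ∀ i, δ i ≤ 1/2 := fun i => by
    have h1 : Real.exp (-(t (Fin.castAdd (n+1) i))) ≤ 1 :=
      Real.exp_le_one_iff.mpr (by linarith [ht.1 (Fin.castAdd (n+1) i)])
    simp only [hδd]; nlinarith
  set F : Finset (Fin (n+1) → ℤ) :=
    (Fintype.piFinset fun j => Finset.Icc (-⌊R j⌋) ⌊R j⌋) with hF
  set G : Finset (Fin (n+1) → ℤ) :=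
    (Fintype.piFinset fun _ => Finset.Icc (-(K:ℤ)) K) with hG
  set A : (Fin (n+1) → ℤ) → Set (Fin m → Fin (n+1) → ℝ) := fun q =>
    {Y | Y ∈ Metric.closedBall X r ∧
        ∀ i, ∃ p : ℤ, |∑ j, Y i j * (q j : ℝ) - p| < δ i} with hA
  have hsub : diSingle m (n+1) ε t ∩ Metric.closedBall X r ⊆
      ⋃ q ∈ F.filter (· ≠ 0), A q := by
    rintro Y ⟨⟨q, p, hq, h1, h2⟩, hY⟩
    simp only [Set.mem_iUnion, exists_prop]
    refine ⟨q, ?_, hY, fun i => ⟨p i, h1 i⟩⟩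
    rw [Finset.mem_filter, hF, Fintype.mem_piFinset]
    refine ⟨fun j => ?_, hq⟩
    have h3 : |q j| ≤ ⌊R j⌋ := Int.le_floor.mpr (by
      push_cast; exact (h2 j).le)
    rw [Finset.mem_Icc]
    exact abs_le.mp h3
  set P : ℝ := ∏ i, (2 * δ i) with hP
  have hP0 : 0 ≤ P := Finset.prod_nonneg fun i _ => by linarith [hδ i]
  set V : ℝ := ((2 * r) ^ (n+1)) ^ m with hV
  have hV0 : 0 ≤ V := by positivity
  set b : ℝ := (1 + 1 / (r * K)) ^ m with hb
  have hb0 : 0 ≤ b := by positivity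
  set c : ℝ := (1 + 1 / r) ^ m with hc
  have hc0 : 0 ≤ c := by positivity
  have hK' : (0:ℝ) < K := by exact_mod_cast hK
  have hA1 : ∀ q ∈ F.filter (· ≠ 0), volume (A q) ≤
      ENNReal.ofReal (P * (b + if q ∈ G then c else 0) * V) := by
    intro q hq
    have hq0 : q ≠ 0 := (Finset.mem_filter.mp hq).2
    by_cases hqG : q ∈ G
    · obtain ⟨j, hj⟩ := Function.ne_iff.mp hq0
      have hj : q j ≠ 0 := hj
      refine (di_matrix m n q j hj δ r X hδ hδ' hr).trans ?_
      apply ENNReal.ofReal_le_ofReal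
      rw [if_pos hqG]
      have h1 : (1:ℝ) ≤ |(q j : ℝ)| := by exact_mod_cast Int.one_le_abs hj
      have : (1 + 1 / (r * |(q j : ℝ)|)) ^ m ≤ b + c := by
        refine le_trans ?_ (le_add_of_nonneg_left hb0)
        rw [hc]
        gcongr
        nlinarith
      gcongr
    · have : ∃ j, (K:ℤ) < |q j| := by
        by_contra! hcon
        exact hqG (Fintype.mem_piFinset.mpr fun j => Finset.mem_Icc.mpr (abs_le.mp (hcon j)))
      obtain ⟨j, hj⟩ := this
      have hj0 : q j ≠ 0 := by
        intro h; rw [h] at hj; simp at hj; omega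
      refine (di_matrix m n q j hj0 δ r X hδ hδ' hr).trans ?_
      apply ENNReal.ofReal_le_ofReal
      rw [if_neg hqG, add_zero]
      have h1 : (K:ℝ) ≤ |(q j : ℝ)| := by exact_mod_cast hj.le
      rw [hb]
      gcongr
  refine (measure_mono hsub).trans ((measure_biUnion_finset_le _ _).trans
    ((Finset.sum_le_sum hA1).trans ?_))
  rw [← ENNReal.ofReal_sum_of_nonneg (fun q _ => by
    have : 0 ≤ (if q ∈ G then c else 0) := by split_ifs <;> simp [hc0]
    positivity)]
  apply ENNReal.ofReal_le_ofReal
  rw [← Finset.sum_mul, ← Finset.mul_sum, Finset.sum_add_distrib]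
  have hcF : (F.card : ℝ) ≤ ∏ j, (2 * R j + 1) := by
    rw [hF, Fintype.card_piFinset]; push_cast
    refine Finset.prod_le_prod (fun _ _ => by positivity) fun j _ => ?_
    rw [Int.card_Icc]
    have h0 : 0 ≤ ⌊R j⌋ := Int.floor_nonneg.mpr (hR0 j).le
    have : (((⌊R j⌋ + 1 - -⌊R j⌋).toNat : ℕ) : ℝ) = ((⌊R j⌋ + 1 - -⌊R j⌋ : ℤ) : ℝ) := by
      exact_mod_cast congrArg (Int.cast (R := ℝ)) (Int.toNat_of_nonneg (by omega))
    rw [this]; push_cast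
    linarith [Int.floor_le (R j)]
  have hcG : (G.card : ℝ) = (2 * K + 1) ^ (n+1) := by
    have : ((K:ℤ) + 1 - -(K:ℤ)).toNat = 2 * K + 1 := by omega
    rw [hG, Fintype.card_piFinset]
    simp only [Int.card_Icc, this]
    simp
  have hs1 : ∑ q ∈ F.filter (· ≠ 0), b ≤ b * ∏ j, (2 * R j + 1) := by
    rw [Finset.sum_const, nsmul_eq_mul, mul_comm]
    refine mul_le_mul_of_nonneg_left (le_trans ?_ hcF) hb0
    exact_mod_cast Finset.card_filter_le _ _
  have hs2 : ∑ q ∈ F.filter (· ≠ 0), (if q ∈ G then c else 0) ≤ (2 * K + 1) ^ (n+1) * c := by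
    rw [← Finset.sum_filter, Finset.sum_const, nsmul_eq_mul, ← hcG]
    refine mul_le_mul_of_nonneg_right ?_ hc0
    have : (Finset.filter (· ∈ G) (F.filter (· ≠ 0))) ⊆ G := fun q hq =>
      (Finset.mem_filter.mp hq).2
    exact_mod_cast Finset.card_le_card this
  gcongr

theorem di_real_bound (m n : ℕ) (ε : ℝ) (hε : 0 < ε) (t : Fin (m + (n+1)) → ℝ)
    (ht : t ∈ aPlus m (n+1)) (s : ℝ) (hs : ∀ i, s < t i) (b C : ℝ) (hb : 0 ≤ b) (hC : 0 ≤ C) :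
    (∏ i : Fin m, (2 * (ε * Real.exp (-(t (Fin.castAdd (n+1) i)))))) *
        (b * ∏ j : Fin (n+1), (2 * (ε * Real.exp (t (Fin.natAdd m j))) + 1) + C) ≤
    (2 * ε) ^ m * (b * (2 * ε + Real.exp (-s)) ^ (n+1) + C * Real.exp (-s)) := by
  set S : ℝ := ∑ j : Fin (n+1), t (Fin.natAdd m j) with hS
  have h1 : (∏ i : Fin m, (2 * (ε * Real.exp (-(t (Fin.castAdd (n+1) i)))))) =
      (2 * ε) ^ m * Real.exp (-S) := by
    rw [hS, ← ht.2, ← Finset.sum_neg_distrib, Real.exp_sum]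
    simp only [← mul_assoc]
    rw [Finset.prod_mul_distrib]; simp
  have h2 : Real.exp (-S) * ∏ j : Fin (n+1), (2 * (ε * Real.exp (t (Fin.natAdd m j))) + 1) ≤
      (2 * ε + Real.exp (-s)) ^ (n+1) := by
    rw [hS, ← Finset.sum_neg_distrib, Real.exp_sum, ← Finset.prod_mul_distrib]
    calc _ ≤ ∏ j : Fin (n+1), (2 * ε + Real.exp (-s)) := by
          refine Finset.prod_le_prod (fun _ _ => by positivity) fun j _ => ?_
          have e1 : Real.exp (-t (Fin.natAdd m j)) * Real.exp (t (Fin.natAdd m j)) = 1 := by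
            rw [← Real.exp_add]; simp
          have e2 : Real.exp (-t (Fin.natAdd m j)) ≤ Real.exp (-s) :=
            Real.exp_le_exp.mpr (by linarith [hs (Fin.natAdd m j)])
          linear_combination (2 * ε) * e1 + e2
      _ = _ := by simp
  have h3 : Real.exp (-S) ≤ Real.exp (-s) := by
    apply Real.exp_le_exp.mpr
    have : t (Fin.natAdd m 0) ≤ S :=
      Finset.single_le_sum (f := fun j => t (Fin.natAdd m j)) (fun j _ => (ht.1 _).le)
        (Finset.mem_univ 0)
    linarith [hs (Fin.natAdd m 0)]
  rw [h1, mul_assoc]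
  refine mul_le_mul_of_nonneg_left ?_ (by positivity)
  have h4 := mul_le_mul_of_nonneg_left h2 hb
  have h5 := mul_le_mul_of_nonneg_left h3 hC
  linarith

theorem di_choose (m n : ℕ) (ε c r : ℝ) (hr : 0 < r) (hc : (2 * ε) ^ (m + (n+1)) < c) :
    ∃ K : ℕ, 0 < K ∧ ∀ C : ℝ, ∃ s₀ : ℝ, ∀ s ≥ s₀,
      (2 * ε) ^ m * ((1 + 1 / (r * K)) ^ m * (2 * ε + Real.exp (-s)) ^ (n+1)
        + C * Real.exp (-s)) < c := by
  have hE : Filter.Tendsto (fun s : ℝ => Real.exp (-s)) Filter.atTop (nhds 0) :=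
    Real.tendsto_exp_neg_atTop_nhds_zero
  have hK1 : Filter.Tendsto (fun K : ℕ => (1:ℝ) / (r * K)) Filter.atTop (nhds 0) := by
    have := (tendsto_one_div_atTop_nhds_zero_nat (𝕜 := ℝ)).const_mul (1 / r)
    rw [mul_zero] at this
    refine this.congr fun K => ?_
    rw [one_div_mul_one_div]
  have hK2 : Filter.Tendsto (fun K : ℕ => (2 * ε) ^ m * (((1:ℝ) + 1 / (r * K)) ^ m *
      (2 * ε) ^ (n+1))) Filter.atTop (nhds ((2 * ε) ^ m * ((1 + 0) ^ m * (2 * ε) ^ (n+1)))) :=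
    (((hK1.const_add 1).pow m).mul_const _).const_mul _
  have h0 : (2 * ε) ^ m * ((1 + 0) ^ m * (2 * ε) ^ (n+1)) < c := by
    rw [add_zero, one_pow, one_mul, ← pow_add]; exact hc
  obtain ⟨K, hK, hKpos⟩ :=
    ((hK2.eventually_lt_const h0).and (Filter.eventually_gt_atTop 0)).exists
  refine ⟨K, hKpos, fun C => ?_⟩
  have hs : Filter.Tendsto (fun s : ℝ => (2 * ε) ^ m * ((1 + 1 / (r * K)) ^ m *
      (2 * ε + Real.exp (-s)) ^ (n+1) + C * Real.exp (-s))) Filter.atTop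
      (nhds ((2 * ε) ^ m * ((1 + 1 / (r * K)) ^ m * (2 * ε + 0) ^ (n+1) + C * 0))) :=
    ((((hE.const_add _).pow _).const_mul _).add (hE.const_mul _)).const_mul _
  have h1 : (2 * ε) ^ m * ((1 + 1 / (r * K)) ^ m * (2 * ε + 0) ^ (n+1) + C * 0) < c := by
    simpa using hK
  exact Filter.eventually_atTop.mp (hs.eventually_lt_const h1)

theorem diset_volume_zero (m n : ℕ) (hm : 0 < m) (hn : 0 < n)
    (T : Set (Fin (m + n) → ℝ)) (hT : T ⊆ aPlus m n)
    (hdrift : ∀ s : ℝ, 0 < s → ∃ t ∈ T, ∀ i, s < t i)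
    (ε : ℝ) (hε : 0 < ε) (hε' : ε < 1 / 2) :
    volume (DIset m n ε T) = 0 := by
  obtain ⟨n, rfl⟩ : ∃ k, n = k + 1 := ⟨n - 1, by omega⟩
  set E : ℕ → Set (Fin m → Fin (n+1) → ℝ) := fun N =>
    {Y | ∀ t ∈ T, (N : ℝ) < ‖t‖ → Y ∈ diSingle m (n+1) ε t} with hE
  have hsub : DIset m (n+1) ε T ⊆ ⋃ N, E N := by
    rintro Y ⟨t₀, h⟩
    obtain ⟨N, hN⟩ := exists_nat_ge t₀
    exact Set.mem_iUnion.mpr ⟨N, fun t ht htN => h t ht (hN.trans_lt htN)⟩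
  refine measure_mono_null hsub (measure_iUnion_null fun N => ?_)
  have hθ : (2 * ε) ^ (m + (n+1)) < 1 :=
    pow_lt_one₀ (by linarith) (by linarith) (by omega)
  obtain ⟨c, hc1, hc2⟩ := exists_between hθ
  have hc0 : 0 ≤ c := le_trans (by positivity) hc1.le
  have key : ∀ (X : Fin m → Fin (n+1) → ℝ) (r : ℝ), 0 < r →
      volume (E N ∩ Metric.closedBall X r) ≤
        ENNReal.ofReal c * volume (Metric.closedBall X r) := by
    intro X r hr
    obtain ⟨K, hK, hKs⟩ := di_choose m n ε c r hr hc1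
    obtain ⟨s₀, hs₀⟩ := hKs ((2 * K + 1) ^ (n+1) * (1 + 1 / r) ^ m)
    set s : ℝ := max s₀ (N + 1) with hs
    have hsN : (N:ℝ) + 1 ≤ s := le_max_right _ _
    have hN0 : (0:ℝ) ≤ N := by positivity
    obtain ⟨t, htT, hts⟩ := hdrift s (by linarith)
    have htn : (N : ℝ) < ‖t‖ := by
      have h1 := hts (Fin.natAdd m 0)
      have h2 := norm_le_pi_norm t (Fin.natAdd m 0)
      rw [Real.norm_eq_abs] at h2
      linarith [le_abs_self (t (Fin.natAdd m 0))]
    have hsub2 : E N ∩ Metric.closedBall X r ⊆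
        diSingle m (n+1) ε t ∩ Metric.closedBall X r :=
      Set.inter_subset_inter_left _ fun Y hY => hY t htT htn
    refine (measure_mono hsub2).trans
      ((di_sum m n ε hε hε' t (hT htT) X r hr K hK).trans ?_)
    have hvol : volume (Metric.closedBall X r) = ENNReal.ofReal (((2 * r) ^ (n+1)) ^ m) := by
      rw [closedBall_pi _ hr.le, volume_pi_pi]
      simp only [Real.volume_pi_closedBall _ hr.le]
      simp [ENNReal.ofReal_pow (by positivity : (0:ℝ) ≤ (2 * r) ^ (n+1))]
    rw [hvol, ← ENNReal.ofReal_mul hc0]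
    apply ENNReal.ofReal_le_ofReal
    refine mul_le_mul_of_nonneg_right ?_ (by positivity)
    exact (di_real_bound m n ε hε t (hT htT) s hts _ _ (by positivity) (by positivity)).trans
      (hs₀ s (le_max_left _ _)).le
  have hdens := Besicovitch.ae_tendsto_measure_inter_div
    (volume : Measure (Fin m → Fin (n+1) → ℝ)) (E N)
  have hfalse : ∀ᵐ x ∂((volume : Measure (Fin m → Fin (n+1) → ℝ)).restrict (E N)), False := by
    filter_upwards [hdens] with x hx
    have hle : (1 : ENNReal) ≤ ENNReal.ofReal c := by
      refine le_of_tendsto hx ?_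
      filter_upwards [self_mem_nhdsWithin] with r hr
      exact ENNReal.div_le_of_le_mul (key x r hr)
    have : ENNReal.ofReal c < 1 := by
      rw [← ENNReal.ofReal_one]
      exact (ENNReal.ofReal_lt_ofReal_iff one_pos).mpr hc2
    exact absurd hle (not_le.mpr this)
  rw [ae_iff] at hfalse
  simpa using hfalse
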